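/- arXiv:1701.04160 — 2 statements merged into one kernel-verified Lean document; each statement's English description precedes it below -/
import Mathlib

section
/- Let P be the probability measure on ℝ with density (3/2)^n on J_n = [1 - 1/3^(n-1), 1 - 2/3^n] for n ≥ 1. Then ∫ min((x - 1/6)^2, (x - 13/18)^2, (x - 17/18)^2) dP = 29/5508, and for every three-point set α ⊂ ℝ, ∫ min_{a ∈ α} (x - a)^2 dP ≥ 29/5508; thus {1/6, 13/18, 17/18} is an optimal set of three-means with V₃ = 29/5508. -/
open MeasureTheory Set

/-- The interval `J n = [1 - 1/3^(n-1), 1 - 2/3^n]`. -/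
noncomputable def J (n : ℕ) : Set ℝ := Set.Icc (1 - 1 / 3 ^ (n - 1)) (1 - 2 / 3 ^ n)

/-- The piecewise constant density: `(3/2)^n` on `J n` for `n ≥ 1`, `0` elsewhere. -/
noncomputable def f (x : ℝ) : ℝ :=
  ∑' n : ℕ, Set.indicator (J (n + 1)) (fun _ => ((3 : ℝ) / 2) ^ (n + 1)) x

/-- The piecewise uniform probability measure on `ℝ` with density `f`. -/
noncomputable def P : Measure ℝ :=
  MeasureTheory.volume.withDensity (fun x => ENNReal.ofReal (f x))

lemma measurableSet_J (n : ℕ) : MeasurableSet (J n) := measurableSet_Icc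

lemma summable_density (x : ℝ) :
    Summable fun n : ℕ => indicator (J (n + 1)) (fun _ => ((3 : ℝ) / 2) ^ (n + 1)) x := by
  apply summable_of_hasFiniteSupport
  have disjoint_of_lt : ∀ n m : ℕ, n < m → x ∈ J (n + 1) → x ∉ J (m + 1) := by
    intro n m hnm hn hm
    have hpow : (1 : ℝ) / 3 ^ m ≤ 1 / 3 ^ (n + 1) :=
      one_div_le_one_div_of_le (by positivity) (pow_le_pow_right₀ (by norm_num) hnm)
    have hpos : (0 : ℝ) < 1 / 3 ^ (n + 1) := by positivity
    have hn' := hn.2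
    have hm' := hm.1
    rw [show (2 : ℝ) / 3 ^ (n + 1) = 2 * (1 / 3 ^ (n + 1)) by ring] at hn'
    simp only [Nat.add_sub_cancel] at hm'
    linarith
  apply Set.Subsingleton.finite
  intro n hn m hm
  have hn' := mem_of_indicator_ne_zero hn
  have hm' := mem_of_indicator_ne_zero hm
  rcases lt_trichotomy n m with h | h | h
  · exact absurd hm' (disjoint_of_lt n m h hn')
  · exact h
  · exact absurd hn' (disjoint_of_lt m n h hm')

lemma f_nonneg (x : ℝ) : 0 ≤ f x :=
  tsum_nonneg fun _ => indicator_nonneg (fun _ _ => by positivity) _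

lemma ofReal_f_eq_tsum (x : ℝ) :
    ENNReal.ofReal (f x) = ∑' n : ℕ,
      indicator (J (n + 1)) (fun _ => ENNReal.ofReal (((3 : ℝ) / 2) ^ (n + 1))) x := by
  rw [f, ENNReal.ofReal_tsum_of_nonneg
    (fun _ => indicator_nonneg (fun _ _ => by positivity) _) (summable_density x)]
  congr 1 with n
  by_cases h : x ∈ J (n + 1) <;> simp [h]

lemma measurable_ofReal_f : Measurable fun x => ENNReal.ofReal (f x) := by
  simp_rw [ofReal_f_eq_tsum]
  exact Measurable.tsum fun n => measurable_const.indicator (measurableSet_J _)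

lemma lintegral_ofReal_f : ∫⁻ x, ENNReal.ofReal (f x) = 1 := by
  simp_rw [ofReal_f_eq_tsum]
  rw [lintegral_tsum fun n => (measurable_const.indicator (measurableSet_J _)).aemeasurable]
  have hterm : ∀ n : ℕ, ∫⁻ x, indicator (J (n + 1))
      (fun _ => ENNReal.ofReal (((3 : ℝ) / 2) ^ (n + 1))) x = (2⁻¹ : ENNReal) ^ (n + 1) := by
    intro n
    rw [lintegral_indicator_const (measurableSet_J _), J, Real.volume_Icc,
      ← ENNReal.ofReal_mul (by positivity)]
    rw [show ((3 : ℝ) / 2) ^ (n + 1) * (1 - 2 / 3 ^ (n + 1) - (1 - 1 / 3 ^ (n + 1 - 1)))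
      = (2⁻¹ : ℝ) ^ (n + 1) by
        rw [Nat.add_sub_cancel, div_pow, inv_pow]; field_simp; ring]
    rw [ENNReal.ofReal_pow (by norm_num), ENNReal.ofReal_inv_of_pos (by norm_num)]
    norm_num
  simp_rw [hterm]
  rw [ENNReal.tsum_geometric_add_one, ENNReal.one_sub_inv_two, inv_inv]
  exact ENNReal.inv_mul_cancel (by norm_num) (by norm_num)

instance : IsProbabilityMeasure P := by
  constructor
  rw [P, withDensity_apply _ MeasurableSet.univ, Measure.restrict_univ, lintegral_ofReal_f]

lemma f_eq_zero_of_notMem {x : ℝ} (hx : x ∉ Icc (0 : ℝ) 1) : f x = 0 := by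
  have hmem : ∀ n : ℕ, x ∉ J (n + 1) := by
    intro n h
    apply hx
    have h1 := h.1
    have h2 := h.2
    have hpow : (1 : ℝ) / 3 ^ n ≤ 1 := by
      rw [div_le_one (by positivity)]
      exact one_le_pow₀ (by norm_num)
    have hpos : (0 : ℝ) < 2 / 3 ^ (n + 1) := by positivity
    simp only [Nat.add_sub_cancel] at h1
    constructor <;> linarith
  simp [f, hmem]

lemma ae_mem_Icc : ∀ᵐ x ∂P, x ∈ Icc (0 : ℝ) 1 := by
  rw [P, ae_withDensity_iff measurable_ofReal_f]
  refine Filter.Eventually.of_forall fun x hx => ?_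
  by_contra h
  simp [f_eq_zero_of_notMem h] at hx

lemma integrable_of_continuous {g : ℝ → ℝ} (hg : Continuous g) : Integrable g P := by
  have h := hg.integrableOn_Icc (μ := P) (a := 0) (b := 1)
  rwa [IntegrableOn, Measure.restrict_eq_self_of_ae_mem ae_mem_Icc] at h

lemma integral_P_mono {g h : ℝ → ℝ} (hg : Continuous g) (hh : Continuous h)
    (hgh : ∀ x ∈ Icc (0 : ℝ) 1, g x ≤ h x) : ∫ x, g x ∂P ≤ ∫ x, h x ∂P :=
  integral_mono_ae (integrable_of_continuous hg) (integrable_of_continuous hh)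
    (ae_mem_Icc.mono hgh)

lemma integral_P_congr {g h : ℝ → ℝ} (hgh : ∀ x ∈ Icc (0 : ℝ) 1, g x = h x) :
    ∫ x, g x ∂P = ∫ x, h x ∂P :=
  integral_congr_ae (ae_mem_Icc.mono hgh)

lemma f_self_similar (x : ℝ) :
    f x = indicator (Icc (0 : ℝ) (1 / 3)) (fun _ => (3 : ℝ) / 2) x + 3 / 2 * f (3 * x - 2) := by
  rw [f, (summable_density x).tsum_eq_zero_add, f, ← tsum_mul_left]
  congr 1
  · simp only [J]; norm_num
  · congr 1 with n
    have hiff : x ∈ J (n + 1 + 1) ↔ 3 * x - 2 ∈ J (n + 1) := by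
      simp only [J, mem_Icc, Nat.add_sub_cancel]
      rw [show (1 : ℝ) / 3 ^ n = 3 * (1 / 3 ^ (n + 1)) by field_simp; ring,
        show (2 : ℝ) / 3 ^ (n + 1) = 3 * (2 / 3 ^ (n + 1 + 1)) by field_simp; ring]
      constructor <;> rintro ⟨h1, h2⟩ <;> constructor <;> linarith
    by_cases h : 3 * x - 2 ∈ J (n + 1)
    · simp only [indicator_of_mem (hiff.2 h), indicator_of_mem h]; ring
    · simp only [indicator_of_notMem (mt hiff.1 h), indicator_of_notMem h]; ring

lemma integral_P_eq (g : ℝ → ℝ) : ∫ x, g x ∂P = ∫ x, f x * g x := by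
  rw [P, integral_withDensity_eq_integral_toReal_smul measurable_ofReal_f (by simp)]
  simp [ENNReal.toReal_ofReal, f_nonneg]

lemma integrable_f_mul {g : ℝ → ℝ} (hg : Continuous g) : Integrable fun x => f x * g x := by
  have h := integrable_of_continuous hg
  rw [P, integrable_withDensity_iff_integrable_smul' measurable_ofReal_f (by simp)] at h
  simpa [ENNReal.toReal_ofReal, f_nonneg] using h

/-- `P` is half the uniform law on `[0, 1/3]` plus half the image of `P` under `x ↦ x/3 + 2/3`. -/
lemma integral_P_self_similar {g : ℝ → ℝ} (hg : Continuous g) :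
    ∫ x, g x ∂P =
      3 / 2 * (∫ x in (0 : ℝ)..(1 / 3), g x) + 1 / 2 * ∫ x, g (x / 3 + 2 / 3) ∂P := by
  set F : ℝ → ℝ := fun y => f y * g (y / 3 + 2 / 3) with hF
  have hFint : Integrable F := integrable_f_mul (by fun_prop)
  have hdecomp : ∀ x, f x * g x =
      indicator (Icc (0 : ℝ) (1 / 3)) (fun x => 3 / 2 * g x) x + 3 / 2 * F (3 * x - 2) := by
    intro x
    simp only [hF]
    rw [f_self_similar x, show (3 * x - 2) / 3 + 2 / 3 = x by ring]
    by_cases h : x ∈ Icc (0 : ℝ) (1 / 3)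
    · simp only [indicator_of_mem h]; ring
    · simp only [indicator_of_notMem h]; ring
  have hind : Integrable (indicator (Icc (0 : ℝ) (1 / 3)) fun x => 3 / 2 * g x) :=
    (integrable_indicator_iff measurableSet_Icc).2 (by fun_prop : Continuous _).integrableOn_Icc
  have hshift : Integrable fun x => 3 / 2 * F (3 * x - 2) :=
    ((hFint.comp_sub_right 2).comp_mul_left' (by norm_num : (3 : ℝ) ≠ 0)).const_mul _
  rw [integral_P_eq, integral_P_eq]
  simp_rw [hdecomp]
  rw [integral_add hind hshift, integral_indicator measurableSet_Icc, integral_const_mul,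
    integral_const_mul, integral_Icc_eq_integral_Ioc,
    ← intervalIntegral.integral_of_le (by norm_num),
    Measure.integral_comp_mul_left (fun y => F (y - 2)) 3, integral_sub_right_eq_self F 2]
  rw [abs_of_pos (by norm_num), smul_eq_mul]
  ring

lemma intervalIntegral_sub_sq (a p q : ℝ) :
    ∫ x in p..q, (x - a) ^ 2 = ((q - a) ^ 3 - (p - a) ^ 3) / 3 := by
  rw [intervalIntegral.integral_comp_sub_right (fun x => x ^ 2), integral_pow]
  norm_num

lemma intervalIntegral_mono {g h : ℝ → ℝ} {p q : ℝ} (hpq : p ≤ q) (hg : Continuous g)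
    (hh : Continuous h) (hgh : ∀ x ∈ Icc p q, g x ≤ h x) :
    ∫ x in p..q, g x ≤ ∫ x in p..q, h x :=
  intervalIntegral.integral_mono_on hpq (hg.intervalIntegrable _ _) (hh.intervalIntegrable _ _) hgh

/-- For points `a ≤ b` whose midpoint `(a + b) / 2` lies in `[p, q]`. -/
lemma intervalIntegral_min_sq {a b p q : ℝ} (hab : a ≤ b) (hp : p ≤ (a + b) / 2)
    (hq : (a + b) / 2 ≤ q) :
    ∫ x in p..q, min ((x - a) ^ 2) ((x - b) ^ 2) =
      (2 * ((b - a) / 2) ^ 3 - (p - a) ^ 3 + (q - b) ^ 3) / 3 := by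
  have hc : Continuous fun x : ℝ => min ((x - a) ^ 2) ((x - b) ^ 2) := by fun_prop
  rw [← intervalIntegral.integral_add_adjacent_intervals (b := (a + b) / 2)
    (hc.intervalIntegrable _ _) (hc.intervalIntegrable _ _)]
  have hleft : ∫ x in p..(a + b) / 2, min ((x - a) ^ 2) ((x - b) ^ 2) =
      ∫ x in p..(a + b) / 2, (x - a) ^ 2 := by
    apply intervalIntegral.integral_congr
    intro x hx
    rw [uIcc_of_le hp] at hx
    exact min_eq_left (by nlinarith [hx.2])
  have hright : ∫ x in (a + b) / 2..q, min ((x - a) ^ 2) ((x - b) ^ 2) =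
      ∫ x in (a + b) / 2..q, (x - b) ^ 2 := by
    apply intervalIntegral.integral_congr
    intro x hx
    rw [uIcc_of_le hq] at hx
    exact min_eq_right (by nlinarith [hx.1])
  rw [hleft, hright, intervalIntegral_sub_sq, intervalIntegral_sub_sq]
  ring

lemma integral_P_id : ∫ x, x ∂P = 1 / 2 := by
  have h := integral_P_self_similar (g := fun x => x) continuous_id
  rw [integral_add (integrable_of_continuous (by fun_prop))
    (integrable_of_continuous (by fun_prop)), integral_div, integral_id] at h
  simp only [integral_const, probReal_univ, smul_eq_mul] at h
  linarith

lemma integral_P_sub_sq_eq_add (a b : ℝ) :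
    ∫ x, (x - a) ^ 2 ∂P = ∫ x, (x - b) ^ 2 ∂P + (b - a) * (1 - a - b) := by
  have hexp : ∀ x : ℝ, (x - a) ^ 2 = (x - b) ^ 2 + (2 * (b - a) * x + (a ^ 2 - b ^ 2)) := by
    intro x; ring
  simp_rw [hexp]
  rw [integral_add (integrable_of_continuous (by fun_prop))
    (integrable_of_continuous (by fun_prop)), integral_add
    (integrable_of_continuous (by fun_prop)) (integrable_of_continuous (by fun_prop)),
    integral_const_mul, integral_P_id]
  simp only [integral_const, probReal_univ, smul_eq_mul]
  ring

/-- The mean of `P` is `1/2` and its variance is `25/204`. -/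
lemma integral_P_sub_sq (a : ℝ) : ∫ x, (x - a) ^ 2 ∂P = 25 / 204 + (a - 1 / 2) ^ 2 := by
  have h := integral_P_self_similar (g := fun x => (x - 1 / 2) ^ 2) (by fun_prop)
  have hscale : ∀ x : ℝ, (x / 3 + 2 / 3 - 1 / 2) ^ 2 = 1 / 9 * (x - -(1 / 2)) ^ 2 := by
    intro x; ring
  simp_rw [hscale] at h
  rw [integral_const_mul, integral_P_sub_sq_eq_add (-(1 / 2)) (1 / 2),
    intervalIntegral_sub_sq] at h
  rw [integral_P_sub_sq_eq_add a (1 / 2)]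
  linarith

/-- With one point fixed at `1/2`, no second point beats the midpoint of `[0, 1/3]` there. -/
lemma le_intervalIntegral_min_half (a : ℝ) :
    1 / 324 ≤ ∫ x in (0 : ℝ)..(1 / 3), min ((x - a) ^ 2) ((x - 1 / 2) ^ 2) := by
  have hc : Continuous fun x : ℝ => min ((x - a) ^ 2) ((x - 1 / 2) ^ 2) := by fun_prop
  have of_le : ∀ c : ℝ, (∀ x ∈ Icc (0 : ℝ) (1 / 3),
      (x - c) ^ 2 ≤ min ((x - a) ^ 2) ((x - 1 / 2) ^ 2)) →
      1 / 324 ≤ ∫ x in (0 : ℝ)..(1 / 3), min ((x - a) ^ 2) ((x - 1 / 2) ^ 2) := by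
    intro c hcle
    have h := intervalIntegral_mono (by norm_num) (by fun_prop) hc hcle
    rw [intervalIntegral_sub_sq] at h
    nlinarith [sq_nonneg (c - 1 / 6)]
  rcases le_total (1 / 2) a with h | h
  · exact of_le (1 / 2) fun x hx => le_min (by nlinarith [hx.2]) le_rfl
  rcases le_total (1 / 6) a with h6 | h6
  · exact of_le a fun x hx => le_min le_rfl (by nlinarith [hx.2])
  rcases le_total a (-(1 / 2)) with hn | hn
  · exact of_le (1 / 2) fun x hx => le_min (by nlinarith [hx.1]) le_rfl
  · rw [intervalIntegral_min_sq h (by linarith) (by linarith)]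
    nlinarith [mul_nonneg (sq_nonneg (a - 1 / 6)) (by linarith : 0 ≤ a + 1 / 2),
      sq_nonneg (a - 1 / 6)]

/-- Pulled back to `P`, this bounds the cost on `[2/3, 1]` when one point is `1/2`. -/
lemma le_integral_P_min_neg_half (b : ℝ) :
    25 / 204 ≤ ∫ x, min ((x - -(1 / 2)) ^ 2) ((x - b) ^ 2) ∂P := by
  have hc : Continuous fun x : ℝ => min ((x - -(1 / 2)) ^ 2) ((x - b) ^ 2) := by fun_prop
  have of_le : ∀ c : ℝ, (∀ x ∈ Icc (0 : ℝ) 1,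
      (x - c) ^ 2 ≤ min ((x - -(1 / 2)) ^ 2) ((x - b) ^ 2)) →
      25 / 204 ≤ ∫ x, min ((x - -(1 / 2)) ^ 2) ((x - b) ^ 2) ∂P := by
    intro c hcle
    have h := integral_P_mono (by fun_prop) hc hcle
    rw [integral_P_sub_sq] at h
    nlinarith [sq_nonneg (c - 1 / 2)]
  rcases le_total b (-(1 / 2)) with h | h
  · exact of_le (-(1 / 2)) fun x hx => le_min le_rfl (by nlinarith [hx.1])
  rcases le_total b (1 / 2) with h2 | h2
  · exact of_le b fun x hx => le_min (by nlinarith [hx.1]) le_rfl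
  rw [integral_P_self_similar hc]
  rcases le_total b (5 / 6) with h5 | h5
  · rw [intervalIntegral_min_sq h (by linarith) (by linarith)]
    have hrest : ∫ x, 1 / 9 * (x - (3 * b - 2)) ^ 2 ∂P ≤
        ∫ x, min ((x / 3 + 2 / 3 - -(1 / 2)) ^ 2) ((x / 3 + 2 / 3 - b) ^ 2) ∂P :=
      integral_P_mono (by fun_prop) (by fun_prop) fun x hx =>
        le_min (by nlinarith [hx.1]) (by nlinarith)
    rw [integral_const_mul, integral_P_sub_sq] at hrest
    nlinarith [mul_nonneg (sq_nonneg (b - 1 / 2)) (by linarith : 0 ≤ 5 / 6 - b),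
      sq_nonneg (b - 1 / 2)]
  · have hfirst := intervalIntegral_mono (p := 0) (q := 1 / 3)
      (g := fun x => min ((x - -(1 / 2)) ^ 2) ((x - 5 / 6) ^ 2)) (by norm_num) (by fun_prop) hc
      fun x hx => min_le_min le_rfl (by nlinarith [hx.2])
    rw [intervalIntegral_min_sq (by norm_num) (by norm_num) (by norm_num)] at hfirst
    have hrest : 0 ≤ ∫ x, min ((x / 3 + 2 / 3 - -(1 / 2)) ^ 2) ((x / 3 + 2 / 3 - b) ^ 2) ∂P :=
      integral_nonneg fun x => by positivity
    linarith

/-- Optimal error of two points, for `b₁ ≤ b₂`. -/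
lemma le_integral_P_min_two {b₁ b₂ : ℝ} (hb : b₁ ≤ b₂) :
    7 / 612 ≤ ∫ x, min ((x - b₁) ^ 2) ((x - b₂) ^ 2) ∂P := by
  have hc : Continuous fun x : ℝ => min ((x - b₁) ^ 2) ((x - b₂) ^ 2) := by fun_prop
  rw [integral_P_self_similar hc]
  have hfirst_nonneg : 0 ≤ ∫ x in (0 : ℝ)..(1 / 3), min ((x - b₁) ^ 2) ((x - b₂) ^ 2) :=
    intervalIntegral.integral_nonneg (by norm_num) fun x _ => by positivity
  have hrest_nonneg :
      0 ≤ ∫ x, min ((x / 3 + 2 / 3 - b₁) ^ 2) ((x / 3 + 2 / 3 - b₂) ^ 2) ∂P :=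
    integral_nonneg fun x => by positivity
  rcases le_total b₂ (1 / 2) with h2 | h2
  · have hrest : ∫ x, 1 / 9 * (x - -(1 / 2)) ^ 2 ∂P ≤
        ∫ x, min ((x / 3 + 2 / 3 - b₁) ^ 2) ((x / 3 + 2 / 3 - b₂) ^ 2) ∂P :=
      integral_P_mono (by fun_prop) (by fun_prop) fun x hx =>
        le_min (by nlinarith [hx.1]) (by nlinarith [hx.1])
    rw [integral_const_mul, integral_P_sub_sq] at hrest
    linarith
  rcases le_total b₁ (1 / 2) with h1 | h1
  · have hfirst := (le_intervalIntegral_min_half b₁).trans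
      (intervalIntegral_mono (by norm_num) (by fun_prop) hc
        fun x hx => min_le_min le_rfl (by nlinarith [hx.2]))
    have hrest : ∫ x, 1 / 9 * min ((x - -(1 / 2)) ^ 2) ((x - (3 * b₂ - 2)) ^ 2) ∂P ≤
        ∫ x, min ((x / 3 + 2 / 3 - b₁) ^ 2) ((x / 3 + 2 / 3 - b₂) ^ 2) ∂P := by
      refine integral_P_mono (by fun_prop) (by fun_prop) fun x hx => ?_
      rw [mul_min_of_nonneg _ _ (by norm_num)]
      exact min_le_min (by nlinarith [hx.1]) (by nlinarith)
    rw [integral_const_mul] at hrest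
    linarith [le_integral_P_min_neg_half (3 * b₂ - 2)]
  · have hfirst := intervalIntegral_mono (p := 0) (q := 1 / 3) (g := fun x => (x - 1 / 2) ^ 2)
      (by norm_num) (by fun_prop) hc
      fun x hx => le_min (by nlinarith [hx.2]) (by nlinarith [hx.2])
    rw [intervalIntegral_sub_sq] at hfirst
    linarith

/-- Lower bound for the error of three points `a₁ ≤ a₂ ≤ a₃`. -/
lemma le_integral_P_min_three {a₁ a₂ a₃ : ℝ} (h12 : a₁ ≤ a₂) (h23 : a₂ ≤ a₃) :
    29 / 5508 ≤ ∫ x, min (min ((x - a₁) ^ 2) ((x - a₂) ^ 2)) ((x - a₃) ^ 2) ∂P := by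
  have hc : Continuous fun x : ℝ => min (min ((x - a₁) ^ 2) ((x - a₂) ^ 2)) ((x - a₃) ^ 2) := by
    fun_prop
  rw [integral_P_self_similar hc]
  have hfirst_nonneg : 0 ≤ ∫ x in (0 : ℝ)..(1 / 3),
      min (min ((x - a₁) ^ 2) ((x - a₂) ^ 2)) ((x - a₃) ^ 2) :=
    intervalIntegral.integral_nonneg (by norm_num) fun x _ => by positivity
  have hrest_nonneg : 0 ≤ ∫ x, min (min ((x / 3 + 2 / 3 - a₁) ^ 2) ((x / 3 + 2 / 3 - a₂) ^ 2))
      ((x / 3 + 2 / 3 - a₃) ^ 2) ∂P :=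
    integral_nonneg fun x => by positivity
  rcases le_total a₂ (1 / 2) with h2 | h2
  · have hrest : ∫ x, 1 / 9 * min ((x - -(1 / 2)) ^ 2) ((x - (3 * a₃ - 2)) ^ 2) ∂P ≤
        ∫ x, min (min ((x / 3 + 2 / 3 - a₁) ^ 2) ((x / 3 + 2 / 3 - a₂) ^ 2))
          ((x / 3 + 2 / 3 - a₃) ^ 2) ∂P := by
      refine integral_P_mono (by fun_prop) (by fun_prop) fun x hx => ?_
      rw [mul_min_of_nonneg _ _ (by norm_num)]
      exact min_le_min (le_min (by nlinarith [hx.1]) (by nlinarith [hx.1])) (by nlinarith)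
    rw [integral_const_mul] at hrest
    linarith [le_integral_P_min_neg_half (3 * a₃ - 2)]
  rcases le_total (1 / 3) a₁ with h1 | h1
  · have hfirst := intervalIntegral_mono (p := 0) (q := 1 / 3) (g := fun x => (x - 1 / 3) ^ 2)
      (by norm_num) (by fun_prop) hc
      fun x hx => le_min (le_min (by nlinarith [hx.2]) (by nlinarith [hx.2])) (by nlinarith [hx.2])
    rw [intervalIntegral_sub_sq] at hfirst
    linarith
  rcases le_total 1 a₂ with h2' | h2'
  · have hrest : ∫ x, 1 / 9 * (x - 1) ^ 2 ∂P ≤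
        ∫ x, min (min ((x / 3 + 2 / 3 - a₁) ^ 2) ((x / 3 + 2 / 3 - a₂) ^ 2))
          ((x / 3 + 2 / 3 - a₃) ^ 2) ∂P :=
      integral_P_mono (by fun_prop) (by fun_prop) fun x hx =>
        le_min (le_min (by nlinarith [hx.1, hx.2]) (by nlinarith [hx.2])) (by nlinarith [hx.2])
    rw [integral_const_mul, integral_P_sub_sq] at hrest
    linarith
  · have hfirst := (le_intervalIntegral_min_half a₁).trans
      (intervalIntegral_mono (by norm_num) (by fun_prop) hc fun x hx =>
        le_min (min_le_min le_rfl (by nlinarith [hx.2]))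
          ((min_le_right _ _).trans (by nlinarith [hx.2])))
    have hrest : ∫ x, 1 / 9 * min ((x - (3 * a₂ - 2)) ^ 2) ((x - (3 * a₃ - 2)) ^ 2) ∂P ≤
        ∫ x, min (min ((x / 3 + 2 / 3 - a₁) ^ 2) ((x / 3 + 2 / 3 - a₂) ^ 2))
          ((x / 3 + 2 / 3 - a₃) ^ 2) ∂P := by
      refine integral_P_mono (by fun_prop) (by fun_prop) fun x hx => ?_
      rw [mul_min_of_nonneg _ _ (by norm_num)]
      exact min_le_min (le_min (by nlinarith [hx.1]) (by nlinarith)) (by nlinarith)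
    rw [integral_const_mul] at hrest
    linarith [le_integral_P_min_two (b₁ := 3 * a₂ - 2) (b₂ := 3 * a₃ - 2) (by linarith)]

lemma integral_P_min_optimal :
    ∫ x, min (min ((x - 1 / 6) ^ 2) ((x - 13 / 18) ^ 2)) ((x - 17 / 18) ^ 2) ∂P = 29 / 5508 := by
  rw [integral_P_self_similar (by fun_prop), integral_P_self_similar (by fun_prop)]
  have hfirst : ∫ x in (0 : ℝ)..(1 / 3),
      min (min ((x - 1 / 6) ^ 2) ((x - 13 / 18) ^ 2)) ((x - 17 / 18) ^ 2) =
      ∫ x in (0 : ℝ)..(1 / 3), (x - 1 / 6) ^ 2 := by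
    apply intervalIntegral.integral_congr
    intro x hx
    rw [uIcc_of_le (by norm_num)] at hx
    have hx2 := hx.2
    simp only [min_assoc]
    exact min_eq_left (le_min (by nlinarith) (by nlinarith))
  have hsecond : ∫ x in (0 : ℝ)..(1 / 3), min (min ((x / 3 + 2 / 3 - 1 / 6) ^ 2)
      ((x / 3 + 2 / 3 - 13 / 18) ^ 2)) ((x / 3 + 2 / 3 - 17 / 18) ^ 2) =
      ∫ x in (0 : ℝ)..(1 / 3), 1 / 9 * (x - 1 / 6) ^ 2 := by
    apply intervalIntegral.integral_congr
    intro x hx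
    rw [uIcc_of_le (by norm_num)] at hx
    have hx1 := hx.1
    have hx2 := hx.2
    simp only
    rw [min_eq_right (a := (x / 3 + 2 / 3 - 1 / 6) ^ 2) (by nlinarith), min_eq_left (by nlinarith)]
    ring
  have hrest : ∫ x, min (min (((x / 3 + 2 / 3) / 3 + 2 / 3 - 1 / 6) ^ 2)
      (((x / 3 + 2 / 3) / 3 + 2 / 3 - 13 / 18) ^ 2))
      (((x / 3 + 2 / 3) / 3 + 2 / 3 - 17 / 18) ^ 2) ∂P =
      ∫ x, 1 / 81 * (x - 1 / 2) ^ 2 ∂P := by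
    apply integral_P_congr
    intro x hx
    have hx1 := hx.1
    rw [min_eq_right (le_min (by nlinarith) (by nlinarith))]
    ring
  rw [hfirst, hsecond, hrest, intervalIntegral.integral_const_mul, integral_const_mul,
    intervalIntegral_sub_sq, integral_P_sub_sq]
  norm_num

theorem stmt_7 :
    (∫ x, min (min ((x - 1 / 6) ^ 2) ((x - 13 / 18) ^ 2)) ((x - 17 / 18) ^ 2) ∂P) = 29 / 5508 ∧
    ∀ a₁ a₂ a₃ : ℝ,
      29 / 5508 ≤ ∫ x, min (min ((x - a₁) ^ 2) ((x - a₂) ^ 2)) ((x - a₃) ^ 2) ∂P := by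
  refine ⟨integral_P_min_optimal, fun a₁ a₂ a₃ => ?_⟩
  rcases le_total a₁ a₂ with h12 | h12 <;> rcases le_total a₂ a₃ with h23 | h23 <;>
    rcases le_total a₁ a₃ with h13 | h13
  · exact le_integral_P_min_three h12 h23
  · exact le_integral_P_min_three h12 h23
  · simpa only [min_right_comm] using le_integral_P_min_three h13 h23
  · simpa only [min_comm, min_left_comm, min_assoc] using le_integral_P_min_three h13 h12
  · simpa only [min_comm, min_left_comm, min_assoc] using le_integral_P_min_three h12 h13
  · simpa only [min_comm, min_left_comm, min_assoc] using le_integral_P_min_three h23 h13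
  · simpa only [min_comm, min_left_comm, min_assoc] using le_integral_P_min_three h23 h12
  · simpa only [min_comm, min_left_comm, min_assoc] using le_integral_P_min_three h23 h12
end

section
/- Let P be the probability measure with density 3/2 on [0, 1/3] and 9/4 on [2/3, 7/9] ∪ [8/9, 1]. Then ∫ min over a ∈ {1/12, 1/4, 13/18, 17/18} of (x - a)² dP = 13/7776, and every four-point set α satisfies ∫ min_{a ∈ α}(x - a)² dP ≥ 13/7776; thus {1/12, 1/4, 13/18, 17/18} is an optimal set of four-means with V₄ = 13/7776. -/
open MeasureTheory Set

/-- The density: `3/2` on `[0,1/3]`, `9/4` on `[2/3,7/9] ∪ [8/9,1]`, `0` elsewhere. -/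
noncomputable def g (x : ℝ) : ℝ :=
  Set.indicator (Set.Icc (0 : ℝ) (1 / 3)) (fun _ => (3 : ℝ) / 2) x +
    Set.indicator (Set.Icc ((2 : ℝ) / 3) (7 / 9) ∪ Set.Icc ((8 : ℝ) / 9) 1)
      (fun _ => (9 : ℝ) / 4) x

/-- The piecewise uniform probability measure with finitely many pieces. -/
noncomputable def Q : Measure ℝ :=
  MeasureTheory.volume.withDensity (fun x => ENNReal.ofReal (g x))

/-- Integration against `Q` is a weighted sum of integrals over the three pieces. -/
theorem integral_Q {f : ℝ → ℝ} (hf : Continuous f) :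
    ∫ x, f x ∂Q = 3 / 2 * (∫ x in (0 : ℝ)..1 / 3, f x) +
      9 / 4 * ((∫ x in (2 / 3 : ℝ)..7 / 9, f x) + ∫ x in (8 / 9 : ℝ)..1, f x) := by
  have hg : Measurable g :=
    (measurable_const.indicator measurableSet_Icc).add
      (measurable_const.indicator (measurableSet_Icc.union measurableSet_Icc))
  have hg0 : ∀ x, 0 ≤ g x := fun x =>
    add_nonneg (indicator_nonneg (fun _ _ => by norm_num) x)
      (indicator_nonneg (fun _ _ => by norm_num) x)
  have hi : ∀ c d k : ℝ, Integrable ((Icc c d).indicator fun x => k * f x) := fun c d k =>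
    (integrable_indicator_iff measurableSet_Icc).2
      (continuous_const.mul hf).continuousOn.integrableOn_Icc
  have hint : ∀ c d k : ℝ, c ≤ d →
      ∫ x, (Icc c d).indicator (fun x => k * f x) x = k * ∫ x in c..d, f x := by
    intro c d k hcd
    rw [integral_indicator measurableSet_Icc, integral_Icc_eq_integral_Ioc,
      ← intervalIntegral.integral_of_le hcd, intervalIntegral.integral_const_mul]
  have hpt : ∀ x, g x * f x = (Icc 0 (1 / 3)).indicator (fun x => 3 / 2 * f x) x +
      ((Icc (2 / 3) (7 / 9)).indicator (fun x => 9 / 4 * f x) x +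
        (Icc (8 / 9) 1).indicator (fun x => 9 / 4 * f x) x) := by
    intro x
    have hd : Disjoint (Icc (2 / 3 : ℝ) (7 / 9)) (Icc (8 / 9) 1) :=
      Set.disjoint_left.2 fun y hy hy' => by
        have := hy.2
        have := hy'.1
        linarith
    rw [g, indicator_union_of_disjoint hd]
    simp only [indicator]
    split_ifs <;> ring
  rw [Q, integral_withDensity_eq_integral_toReal_smul hg.ennreal_ofReal
    (Filter.Eventually.of_forall fun _ => ENNReal.ofReal_lt_top)]
  simp only [ENNReal.toReal_ofReal (hg0 _), smul_eq_mul, hpt]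
  rw [integral_add (hi _ _ _) ((hi _ _ _).fun_add (hi _ _ _)), integral_add (hi _ _ _) (hi _ _ _),
    hint _ _ _ (by norm_num), hint _ _ _ (by norm_num), hint _ _ _ (by norm_num)]
  ring

theorem integral_sub_sq (a c d : ℝ) :
    ∫ x in c..d, (x - a) ^ 2 = ((d - a) ^ 3 - (c - a) ^ 3) / 3 := by
  rw [intervalIntegral.integral_comp_sub_right (fun x => x ^ 2) a, integral_pow]
  norm_num

theorem integral_eq_of_eq_sq {f : ℝ → ℝ} {a c d : ℝ} (hcd : c ≤ d)
    (h : ∀ x ∈ Icc c d, f x = (x - a) ^ 2) :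
    ∫ x in c..d, f x = ((d - a) ^ 3 - (c - a) ^ 3) / 3 := by
  rw [← integral_sub_sq]
  exact intervalIntegral.integral_congr fun x hx => h x (by rwa [uIcc_of_le hcd] at hx)

theorem le_integral_of_sq_le {f : ℝ → ℝ} (hf : Continuous f) {a c d : ℝ} (hcd : c ≤ d)
    (h : ∀ x ∈ Icc c d, (x - a) ^ 2 ≤ f x) :
    ((d - a) ^ 3 - (c - a) ^ 3) / 3 ≤ ∫ x in c..d, f x := by
  rw [← integral_sub_sq]
  exact intervalIntegral.integral_mono_on hcd
    (Continuous.intervalIntegrable (by fun_prop) _ _) (hf.intervalIntegrable _ _) h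

/-- Where `f` dominates the squared distance to `{a, b}`, the integral of `f` is at least the cost
of serving everything to the left of some point by `a` and the rest by `b`. -/
theorem exists_split_le_integral {f : ℝ → ℝ} (hf : Continuous f) {a b c d : ℝ} (hab : a ≤ b)
    (hcd : c ≤ d) (h : ∀ x ∈ Icc c d, (x - a) ^ 2 ≤ f x ∨ (x - b) ^ 2 ≤ f x) :
    ∃ m ∈ Icc c d, ((m - a) ^ 3 - (c - a) ^ 3) / 3 + ((d - b) ^ 3 - (m - b) ^ 3) / 3 ≤
      ∫ x in c..d, f x := by
  have hl : ∀ x ∈ Icc c d, x ≤ (a + b) / 2 → (x - a) ^ 2 ≤ f x := fun x hx hxm =>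
    (h x hx).elim id fun h' => le_trans (by nlinarith) h'
  have hr : ∀ x ∈ Icc c d, (a + b) / 2 ≤ x → (x - b) ^ 2 ≤ f x := fun x hx hxm =>
    (h x hx).elim (fun h' => le_trans (by nlinarith) h') id
  rcases le_total ((a + b) / 2) c with hc | hc
  · refine ⟨c, ⟨le_rfl, hcd⟩, ?_⟩
    have := le_integral_of_sq_le hf hcd fun x hx => hr x hx (hc.trans hx.1)
    linarith
  rcases le_total d ((a + b) / 2) with hd | hd
  · refine ⟨d, ⟨hcd, le_rfl⟩, ?_⟩
    have := le_integral_of_sq_le hf hcd fun x hx => hl x hx (hx.2.trans hd)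
    linarith
  · refine ⟨(a + b) / 2, ⟨hc, hd⟩, ?_⟩
    rw [← intervalIntegral.integral_add_adjacent_intervals
      (hf.intervalIntegrable c ((a + b) / 2)) (hf.intervalIntegrable ((a + b) / 2) d)]
    exact add_le_add
      (le_integral_of_sq_le hf hc fun x hx => hl x ⟨hx.1, hx.2.trans hd⟩ hx.2)
      (le_integral_of_sq_le hf hd fun x hx => hr x ⟨hc.trans hx.1, hx.2⟩ hx.1)

/-- Two points serve a single interval at cost at least `(d - c) ^ 3 / 48`. -/
theorem two_point_le_integral {f : ℝ → ℝ} (hf : Continuous f) {a b c d : ℝ} (hab : a ≤ b)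
    (hcd : c ≤ d) (h : ∀ x ∈ Icc c d, (x - a) ^ 2 ≤ f x ∨ (x - b) ^ 2 ≤ f x) :
    (d - c) ^ 3 / 48 ≤ ∫ x in c..d, f x := by
  obtain ⟨m, ⟨hm₁, hm₂⟩, hm⟩ := exists_split_le_integral hf hab hcd h
  refine le_trans ?_ hm
  have h₁ := mul_nonneg (sub_nonneg.2 hm₁) (sq_nonneg (2 * a - c - m))
  have h₂ := mul_nonneg (sub_nonneg.2 hm₂) (sq_nonneg (2 * b - d - m))
  have h₃ := mul_nonneg (sub_nonneg.2 hcd) (sq_nonneg (2 * m - c - d))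
  linarith

/-- The two right-hand pieces cost two points at least what one midpoint each would. -/
theorem two_point_right_le_integral {f : ℝ → ℝ} (hf : Continuous f) {a b : ℝ} (hab : a ≤ b)
    (h : ∀ x ∈ Icc (2 / 3 : ℝ) 1, (x - a) ^ 2 ≤ f x ∨ (x - b) ^ 2 ≤ f x) :
    1 / 4374 ≤ (∫ x in (2 / 3 : ℝ)..7 / 9, f x) + ∫ x in (8 / 9 : ℝ)..1, f x := by
  have hl : ∀ x ∈ Icc (2 / 3 : ℝ) 1, x ≤ (a + b) / 2 → (x - a) ^ 2 ≤ f x := fun x hx hxm =>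
    (h x hx).elim id fun h' => le_trans (by nlinarith) h'
  have hr : ∀ x ∈ Icc (2 / 3 : ℝ) 1, (a + b) / 2 ≤ x → (x - b) ^ 2 ≤ f x := fun x hx hxm =>
    (h x hx).elim (fun h' => le_trans (by nlinarith) h') id
  rcases le_total ((a + b) / 2) (5 / 6) with hc | hc
  · have h₂ := le_integral_of_sq_le (c := 8 / 9) (d := 1) hf (by norm_num) fun x hx =>
      hr x ⟨by linarith [hx.1], hx.2⟩ (by linarith [hx.1])
    obtain ⟨m, ⟨hm₁, hm₂⟩, h₁⟩ := exists_split_le_integral (c := 2 / 3) (d := 7 / 9) hf hab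
      (by norm_num) fun x hx => h x ⟨hx.1, by linarith [hx.2]⟩
    have k₁ := mul_nonneg (sub_nonneg.2 hm₁) (sq_nonneg (2 * a - 2 / 3 - m))
    have k₂ := mul_nonneg (sub_nonneg.2 hm₁) (sq_nonneg (b - 17 / 18))
    have k₃ := mul_nonneg (sub_nonneg.2 hm₂) (sq_nonneg (2 * b - 17 / 18 - (7 / 9 + m) / 2))
    have k₄ := mul_nonneg (sub_nonneg.2 hm₁) (sub_nonneg.2 hm₂)
    have k₅ := mul_nonneg (sub_nonneg.2 hm₂) (sub_nonneg.2 hm₂)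
    nlinarith [mul_nonneg (sub_nonneg.2 hm₂) k₅, mul_nonneg (sub_nonneg.2 hm₁) k₅]
  · have h₁ := le_integral_of_sq_le (c := 2 / 3) (d := 7 / 9) hf (by norm_num) fun x hx =>
      hl x ⟨hx.1, by linarith [hx.2]⟩ (by linarith [hx.2])
    obtain ⟨m, ⟨hm₁, hm₂⟩, h₂⟩ := exists_split_le_integral (c := 8 / 9) (d := 1) hf hab
      (by norm_num) fun x hx => h x ⟨by linarith [hx.1], hx.2⟩
    have k₁ := mul_nonneg (sub_nonneg.2 hm₂) (sq_nonneg (2 * b - 1 - m))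
    have k₂ := mul_nonneg (sub_nonneg.2 hm₂) (sq_nonneg (a - 13 / 18))
    have k₃ := mul_nonneg (sub_nonneg.2 hm₁) (sq_nonneg (2 * a - 13 / 18 - (8 / 9 + m) / 2))
    have k₄ := mul_nonneg (sub_nonneg.2 hm₁) (sub_nonneg.2 hm₂)
    have k₅ := mul_nonneg (sub_nonneg.2 hm₁) (sub_nonneg.2 hm₁)
    nlinarith [mul_nonneg (sub_nonneg.2 hm₁) k₅, mul_nonneg (sub_nonneg.2 hm₂) k₅]

theorem exists_le_min_min (p q r s : ℝ) :
    p ≤ min (min p q) (min r s) ∨ q ≤ min (min p q) (min r s) ∨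
      r ≤ min (min p q) (min r s) ∨ s ≤ min (min p q) (min r s) := by
  grind

/-- The lower bound for four points listed in increasing order. -/
theorem le_integral_Q_of_sorted {f : ℝ → ℝ} (hf : Continuous f) (hf0 : ∀ x, 0 ≤ f x)
    {b₁ b₂ b₃ b₄ : ℝ} (h₁₂ : b₁ ≤ b₂) (h₂₃ : b₂ ≤ b₃) (h₃₄ : b₃ ≤ b₄)
    (h : ∀ x, (x - b₁) ^ 2 ≤ f x ∨ (x - b₂) ^ 2 ≤ f x ∨ (x - b₃) ^ 2 ≤ f x ∨
      (x - b₄) ^ 2 ≤ f x) :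
    13 / 7776 ≤ ∫ x, f x ∂Q := by
  rw [integral_Q hf]
  have hL : 0 ≤ ∫ x in (0 : ℝ)..1 / 3, f x :=
    intervalIntegral.integral_nonneg (by norm_num) fun x _ => hf0 x
  have hM : 0 ≤ ∫ x in (2 / 3 : ℝ)..7 / 9, f x :=
    intervalIntegral.integral_nonneg (by norm_num) fun x _ => hf0 x
  have hR : 0 ≤ ∫ x in (8 / 9 : ℝ)..1, f x :=
    intervalIntegral.integral_nonneg (by norm_num) fun x _ => hf0 x
  rcases le_total b₃ (3 / 5) with h3 | h3
  · rcases le_total b₄ (5 / 6) with h4 | h4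
    · have := le_integral_of_sq_le (a := 5 / 6) (c := 8 / 9) (d := 1) hf (by norm_num)
        fun x hx => by
          have := hx.1
          rcases h x with h | h | h | h <;> exact le_trans (by nlinarith) h
      linarith
    · have k₁ := le_integral_of_sq_le (a := 3 / 5) (c := 2 / 3) (d := 43 / 60) hf (by norm_num)
        fun x hx => by
          have := hx.1
          have := hx.2
          rcases h x with h | h | h | h <;> exact le_trans (by nlinarith) h
      have k₂ := le_integral_of_sq_le (a := 5 / 6) (c := 43 / 60) (d := 7 / 9) hf (by norm_num)
        fun x hx => by
          have := hx.1
          have := hx.2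
          rcases h x with h | h | h | h <;> exact le_trans (by nlinarith) h
      rw [← intervalIntegral.integral_add_adjacent_intervals
        (hf.intervalIntegrable (2 / 3) (43 / 60)) (hf.intervalIntegrable (43 / 60) (7 / 9))]
      linarith
  rcases le_total b₂ (1 / 15) with h2 | h2
  · have k₁ := le_integral_of_sq_le (a := 1 / 15) (c := 1 / 15) (d := 1 / 3) hf (by norm_num)
      fun x hx => by
        have := hx.1
        have := hx.2
        rcases h x with h | h | h | h <;> exact le_trans (by nlinarith) h
    have k₂ : 0 ≤ ∫ x in (0 : ℝ)..1 / 15, f x :=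
      intervalIntegral.integral_nonneg (by norm_num) fun x _ => hf0 x
    rw [← intervalIntegral.integral_add_adjacent_intervals
      (hf.intervalIntegrable 0 (1 / 15)) (hf.intervalIntegrable (1 / 15) (1 / 3))]
    linarith
  rcases le_total b₂ (1 / 3) with h2' | h2'
  · have k₁ := two_point_le_integral (c := 0) (d := 1 / 3) hf h₁₂ (by norm_num) fun x hx => by
      have := hx.2
      rcases h x with h | h | h | h
      · exact Or.inl h
      · exact Or.inr h
      · exact Or.inr (le_trans (by nlinarith) h)
      · exact Or.inr (le_trans (by nlinarith) h)
    have k₂ := two_point_right_le_integral hf ((min_le_left b₃ 1).trans h₃₄) fun x hx => by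
      have := hx.1
      have := hx.2
      rcases le_total b₃ 1 with h3' | h3'
      · rw [min_eq_left h3']
        rcases h x with h | h | h | h
        · exact Or.inl (le_trans (by nlinarith) h)
        · exact Or.inl (le_trans (by nlinarith) h)
        · exact Or.inl h
        · exact Or.inr h
      · rw [min_eq_right h3']
        rcases h x with h | h | h | h <;> exact Or.inl (le_trans (by nlinarith) h)
    linarith
  · obtain ⟨m, ⟨hm₁, hm₂⟩, k⟩ := exists_split_le_integral (c := 0) (d := 1 / 3) hf
      (min_le_right b₁ (1 / 3)) (by norm_num) fun x hx => by
        have := hx.2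
        rcases h x with h | h | h | h
        · rcases le_total b₁ (1 / 3) with h1 | h1
          · exact Or.inl (by rwa [min_eq_left h1])
          · exact Or.inr (le_trans (by nlinarith) h)
        all_goals exact Or.inr (le_trans (by nlinarith) h)
    have k₁ := mul_nonneg hm₁ (sq_nonneg (2 * min b₁ (1 / 3) - m))
    have k₂ := mul_nonneg hm₁ (sq_nonneg (m - 2 / 9))
    have k₃ := mul_nonneg (sub_nonneg.2 hm₂) (sq_nonneg (m - 2 / 9))
    nlinarith

theorem stmt_16 :
    (∫ x, min (min ((x - 1 / 12) ^ 2) ((x - 1 / 4) ^ 2))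
        (min ((x - 13 / 18) ^ 2) ((x - 17 / 18) ^ 2)) ∂Q) = 13 / 7776 ∧
    ∀ a₁ a₂ a₃ a₄ : ℝ,
      13 / 7776 ≤ ∫ x, min (min ((x - a₁) ^ 2) ((x - a₂) ^ 2))
        (min ((x - a₃) ^ 2) ((x - a₄) ^ 2)) ∂Q := by
  constructor
  · have hf : Continuous fun x : ℝ => min (min ((x - 1 / 12) ^ 2) ((x - 1 / 4) ^ 2))
        (min ((x - 13 / 18) ^ 2) ((x - 17 / 18) ^ 2)) := by fun_prop
    rw [integral_Q hf, ← intervalIntegral.integral_add_adjacent_intervals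
      (hf.intervalIntegrable 0 (1 / 6)) (hf.intervalIntegrable (1 / 6) (1 / 3)),
      integral_eq_of_eq_sq (a := 1 / 12) (c := 0) (by norm_num) fun x hx => ?_,
      integral_eq_of_eq_sq (a := 1 / 4) (c := 1 / 6) (by norm_num) fun x hx => ?_,
      integral_eq_of_eq_sq (a := 13 / 18) (c := 2 / 3) (by norm_num) fun x hx => ?_,
      integral_eq_of_eq_sq (a := 17 / 18) (c := 8 / 9) (by norm_num) fun x hx => ?_]
    · norm_num
    all_goals
      obtain ⟨hx₁, hx₂⟩ := hx
      apply le_antisymm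
      · simp
      · refine le_min (le_min ?_ ?_) (le_min ?_ ?_) <;> nlinarith
  · intro a₁ a₂ a₃ a₄
    let a : Fin 4 → ℝ := ![a₁, a₂, a₃, a₄]
    have hmono : Monotone (a ∘ Tuple.sort a) := Tuple.monotone_sort a
    refine le_integral_Q_of_sorted (by fun_prop)
      (fun x => le_min (le_min (sq_nonneg _) (sq_nonneg _)) (le_min (sq_nonneg _) (sq_nonneg _)))
      (hmono (by decide : (0 : Fin 4) ≤ 1)) (hmono (by decide : (1 : Fin 4) ≤ 2))
      (hmono (by decide : (2 : Fin 4) ≤ 3)) fun x => ?_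
    have hex : ∃ i, (x - a i) ^ 2 ≤ min (min ((x - a₁) ^ 2) ((x - a₂) ^ 2))
        (min ((x - a₃) ^ 2) ((x - a₄) ^ 2)) := by
      rcases exists_le_min_min ((x - a₁) ^ 2) ((x - a₂) ^ 2) ((x - a₃) ^ 2) ((x - a₄) ^ 2) with
        h | h | h | h
      exacts [⟨0, h⟩, ⟨1, h⟩, ⟨2, h⟩, ⟨3, h⟩]
    obtain ⟨i, hi⟩ := hex
    obtain ⟨j, rfl⟩ := (Tuple.sort a).surjective i
    fin_cases j
    exacts [Or.inl hi, Or.inr (Or.inl hi), Or.inr (Or.inr (Or.inl hi)),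
      Or.inr (Or.inr (Or.inr hi))]
end
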